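/- Let λ, μ ∈ (0,∞) and 0 < t < T. For all u, r ∈ [0,1], the function s ↦ I_{1,t}(u,s) + I_{1,T−t}(s,r) attains its minimum on [0,1], and I_{1,T}(u,r) = min_{s∈[0,1]} [ I_{1,t}(u,s) + I_{1,T−t}(s,r) ]. -/

import Mathlib

noncomputable section

open MeasureTheory Real Filter

/-- Probability that an initially inactive edge is active at time `t`. -/
def p01 (lam mu t : ℝ) : ℝ := (lam - lam * Real.exp (-(t * (lam + mu)))) / (lam + mu)

/-- Probability that an initially active edge is active at time `t`. -/
def p11 (lam mu t : ℝ) : ℝ := (lam + mu * Real.exp (-(t * (lam + mu)))) / (lam + mu)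

/-- The cumulant-type function `J_{t,v}(u)`. -/
def Jfun (lam mu t v u : ℝ) : ℝ :=
  u * Real.log (1 - p11 lam mu t + Real.exp v * p11 lam mu t) +
  (1 - u) * Real.log (1 - p01 lam mu t + Real.exp v * p01 lam mu t)

/-- The one-step rate function `I_{1,t}(u,x) = sup_v [v x - J_{t,v}(u)]`. -/
def I1 (lam mu t u x : ℝ) : ℝ := ⨆ v : ℝ, (v * x - Jfun lam mu t v u)

/-- Cumulant generating function of a Bernoulli variable. -/
def Lb (p v : ℝ) : ℝ := Real.log (1 - p + Real.exp v * p)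

/-- Tilted Bernoulli parameter. -/
def th (p v : ℝ) : ℝ := Real.exp v * p / (1 - p + Real.exp v * p)

/-- Rate function with general parameters. -/
def Gr (p q u x : ℝ) : ℝ := ⨆ v : ℝ, (v * x - (u * Lb p v + (1 - u) * Lb q v))

lemma den_pos {p : ℝ} (h0 : 0 < p) (h1 : p < 1) (v : ℝ) : 0 < 1 - p + Real.exp v * p := by
  have := mul_pos (Real.exp_pos v) h0
  linarith

lemma th_pos {p : ℝ} (h0 : 0 < p) (h1 : p < 1) (v : ℝ) : 0 < th p v :=
  div_pos (mul_pos (Real.exp_pos v) h0) (den_pos h0 h1 v)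

lemma th_lt {p : ℝ} (h0 : 0 < p) (h1 : p < 1) (v : ℝ) : th p v < 1 := by
  unfold th
  rw [div_lt_one (den_pos h0 h1 v)]
  linarith

lemma amgm {θ : ℝ} (h0 : 0 < θ) (h1 : θ < 1) (x : ℝ) : θ * x ≤ Real.log (1 - θ + θ * Real.exp x) := by
  have hp : 0 < 1 - θ + θ * Real.exp x := by
    have := mul_pos h0 (Real.exp_pos x)
    linarith
  rw [Real.le_log_iff_exp_le hp]
  have := convexOn_exp.2 (Set.mem_univ (0:ℝ)) (Set.mem_univ x) (by linarith : 0 ≤ 1 - θ) h0.le (by ring)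
  simpa using this

lemma tang {p : ℝ} (h0 : 0 < p) (h1 : p < 1) (v w : ℝ) :
    Lb p w + (v - w) * th p w ≤ Lb p v := by
  have h := amgm (th_pos h0 h1 w) (th_lt h0 h1 w) (v - w)
  have hw := den_pos h0 h1 w
  have hv := den_pos h0 h1 v
  have e : 1 - th p w + th p w * Real.exp (v - w) = (1 - p + Real.exp v * p) / (1 - p + Real.exp w * p) := by
    unfold th
    have := Real.exp_pos w
    rw [Real.exp_sub]
    field_simp
    ring
  rw [e, Real.log_div hv.ne' hw.ne'] at h
  unfold Lb
  linarith

lemma Lb_ge1 {p : ℝ} (h0 : 0 < p) (h1 : p < 1) (v : ℝ) : v + Real.log p ≤ Lb p v := by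
  unfold Lb
  have : v + Real.log p = Real.log (Real.exp v * p) := by
    rw [Real.log_mul (Real.exp_pos v).ne' h0.ne', Real.log_exp]
  rw [this]
  exact Real.log_le_log (mul_pos (Real.exp_pos v) h0) (by linarith)

lemma Lb_ge0 {p : ℝ} (h0 : 0 < p) (h1 : p < 1) (v : ℝ) : Real.log (1 - p) ≤ Lb p v := by
  unfold Lb
  exact Real.log_le_log (by linarith) (by linarith [mul_pos (Real.exp_pos v) h0])

lemma Lb_ge {p x : ℝ} (h0 : 0 < p) (h1 : p < 1) (hx0 : 0 ≤ x) (hx1 : x ≤ 1) (v : ℝ) :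
    v * x + (x * Real.log p + (1 - x) * Real.log (1 - p)) ≤ Lb p v := by
  nlinarith [mul_le_mul_of_nonneg_left (Lb_ge1 h0 h1 v) hx0,
    mul_le_mul_of_nonneg_left (Lb_ge0 h0 h1 v) (by linarith : 0 ≤ 1 - x)]

lemma Gr_upper {p q u x : ℝ} (hp0 : 0 < p) (hp1 : p < 1) (hq0 : 0 < q) (hq1 : q < 1)
    (hu0 : 0 ≤ u) (hu1 : u ≤ 1) (hx0 : 0 ≤ x) (hx1 : x ≤ 1) (v : ℝ) :
    v * x - (u * Lb p v + (1 - u) * Lb q v) ≤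
      -(u * (x * Real.log p + (1 - x) * Real.log (1 - p)) +
        (1 - u) * (x * Real.log q + (1 - x) * Real.log (1 - q))) := by
  nlinarith [mul_le_mul_of_nonneg_left (Lb_ge hp0 hp1 hx0 hx1 v) hu0,
    mul_le_mul_of_nonneg_left (Lb_ge hq0 hq1 hx0 hx1 v) (by linarith : 0 ≤ 1 - u)]

lemma Gr_le {p q u x : ℝ} (hp0 : 0 < p) (hp1 : p < 1) (hq0 : 0 < q) (hq1 : q < 1)
    (hu0 : 0 ≤ u) (hu1 : u ≤ 1) (hx0 : 0 ≤ x) (hx1 : x ≤ 1) :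
    Gr p q u x ≤
      -(u * (x * Real.log p + (1 - x) * Real.log (1 - p)) +
        (1 - u) * (x * Real.log q + (1 - x) * Real.log (1 - q))) :=
  ciSup_le (Gr_upper hp0 hp1 hq0 hq1 hu0 hu1 hx0 hx1)

lemma le_Gr {p q u x : ℝ} (hp0 : 0 < p) (hp1 : p < 1) (hq0 : 0 < q) (hq1 : q < 1)
    (hu0 : 0 ≤ u) (hu1 : u ≤ 1) (hx0 : 0 ≤ x) (hx1 : x ≤ 1) (v : ℝ) :
    v * x - (u * Lb p v + (1 - u) * Lb q v) ≤ Gr p q u x :=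
  le_ciSup (f := fun v : ℝ => v * x - (u * Lb p v + (1 - u) * Lb q v))
    ⟨_, Set.forall_mem_range.2 (Gr_upper hp0 hp1 hq0 hq1 hu0 hu1 hx0 hx1)⟩ v

/-- At the tilted mean, the supremum is bounded by the value at the tilt. -/
lemma Gr_le_tilt {p q u x : ℝ} (hp0 : 0 < p) (hp1 : p < 1) (hq0 : 0 < q) (hq1 : q < 1)
    (hu0 : 0 ≤ u) (hu1 : u ≤ 1) (w : ℝ) (hx : x = u * th p w + (1 - u) * th q w) :
    Gr p q u x ≤ w * x - (u * Lb p w + (1 - u) * Lb q w) := by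
  refine ciSup_le fun v => ?_
  subst hx
  nlinarith [mul_le_mul_of_nonneg_left (tang hp0 hp1 v w) hu0,
    mul_le_mul_of_nonneg_left (tang hq0 hq1 v w) (by linarith : 0 ≤ 1 - u)]

lemma Gr_one_ge {p q u : ℝ} (hp0 : 0 < p) (hp1 : p < 1) (hq0 : 0 < q) (hq1 : q < 1)
    (hu0 : 0 ≤ u) (hu1 : u ≤ 1) :
    -(u * Real.log p + (1 - u) * Real.log q) ≤ Gr p q u 1 := by
  have key : ∀ p : ℝ, 0 < p → p < 1 → Tendsto (fun v => Lb p v - v) atTop (nhds (Real.log p)) := by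
    intro p h0 h1
    have e : (fun v => Lb p v - v) = fun v => Real.log ((1 - p) * Real.exp (-v) + p) := by
      funext v
      have : 1 - p + Real.exp v * p = Real.exp v * ((1 - p) * Real.exp (-v) + p) := by
        rw [Real.exp_neg]
        have := Real.exp_pos v
        field_simp
      have h2 : 0 < (1 - p) * Real.exp (-v) + p := by
        have := mul_pos (sub_pos.2 h1) (Real.exp_pos (-v))
        linarith
      unfold Lb
      rw [this, Real.log_mul (Real.exp_pos v).ne' h2.ne', Real.log_exp]
      ring
    rw [e]
    have h3 : Tendsto (fun v : ℝ => (1 - p) * Real.exp (-v) + p) atTop (nhds p) := by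
      simpa using (Real.tendsto_exp_neg_atTop_nhds_zero.const_mul (1 - p)).add_const p
    exact h3.log h0.ne'
  have h := (((key p hp0 hp1).const_mul u).add ((key q hq0 hq1).const_mul (1 - u))).neg
  refine le_of_tendsto h (Eventually.of_forall fun v => ?_)
  have := le_Gr hp0 hp1 hq0 hq1 hu0 hu1 zero_le_one le_rfl v
  linarith

lemma Gr_zero_ge {p q u : ℝ} (hp0 : 0 < p) (hp1 : p < 1) (hq0 : 0 < q) (hq1 : q < 1)
    (hu0 : 0 ≤ u) (hu1 : u ≤ 1) :
    -(u * Real.log (1 - p) + (1 - u) * Real.log (1 - q)) ≤ Gr p q u 0 := by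
  have key : ∀ p : ℝ, 0 < p → p < 1 → Tendsto (fun v => Lb p v) atBot (nhds (Real.log (1 - p))) := by
    intro p h0 h1
    have h3 : Tendsto (fun v : ℝ => 1 - p + Real.exp v * p) atBot (nhds (1 - p)) := by
      simpa using (Real.tendsto_exp_atBot.mul_const p).const_add (1 - p)
    exact h3.log (by linarith)
  have h := (((key p hp0 hp1).const_mul u).add ((key q hq0 hq1).const_mul (1 - u))).neg
  refine le_of_tendsto h (Eventually.of_forall fun v => ?_)
  have := le_Gr hp0 hp1 hq0 hq1 hu0 hu1 le_rfl zero_le_one v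
  linarith

lemma exists_tilt {p q u r : ℝ} (hp0 : 0 < p) (hp1 : p < 1) (hq0 : 0 < q) (hq1 : q < 1)
    (hr0 : 0 < r) (hr1 : r < 1) :
    ∃ v, r = u * th p v + (1 - u) * th q v := by
  have hb : ∀ p : ℝ, 0 < p → p < 1 → Tendsto (th p) atBot (nhds 0) := by
    intro p h0 h1
    have h2 : Tendsto (fun v : ℝ => Real.exp v * p) atBot (nhds 0) := by
      simpa using Real.tendsto_exp_atBot.mul_const p
    have h3 : Tendsto (fun v : ℝ => 1 - p + Real.exp v * p) atBot (nhds (1 - p)) := by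
      simpa using h2.const_add (1 - p)
    have := h2.div h3 (by linarith)
    rw [zero_div] at this
    exact this
  have ht : ∀ p : ℝ, 0 < p → p < 1 → Tendsto (th p) atTop (nhds 1) := by
    intro p h0 h1
    have e : th p = fun v => p / ((1 - p) * Real.exp (-v) + p) := by
      funext v
      have := den_pos h0 h1 v
      have h2 : 0 < (1 - p) * Real.exp (-v) + p := by
        have := mul_pos (sub_pos.2 h1) (Real.exp_pos (-v))
        linarith
      unfold th
      rw [div_eq_div_iff this.ne' h2.ne', Real.exp_neg]
      have := Real.exp_pos v
      field_simp
    rw [e]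
    have h3 : Tendsto (fun v : ℝ => (1 - p) * Real.exp (-v) + p) atTop (nhds p) := by
      simpa using (Real.tendsto_exp_neg_atTop_nhds_zero.const_mul (1 - p)).add_const p
    have := (tendsto_const_nhds (x := p)).div h3 h0.ne'
    rw [div_self h0.ne'] at this
    exact this
  have hc : ∀ p : ℝ, 0 < p → p < 1 → Continuous (th p) := by
    intro p h0 h1
    unfold th
    exact Continuous.div (by fun_prop) (by fun_prop) fun v => (den_pos h0 h1 v).ne'
  have B := ((hb p hp0 hp1).const_mul u).add ((hb q hq0 hq1).const_mul (1 - u))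
  have U := ((ht p hp0 hp1).const_mul u).add ((ht q hq0 hq1).const_mul (1 - u))
  have C : Continuous fun v => u * th p v + (1 - u) * th q v :=
    ((hc p hp0 hp1).const_mul u).add ((hc q hq0 hq1).const_mul (1 - u))
  obtain ⟨x, hx⟩ := (B.eventually_lt_const (by linarith : u * 0 + (1 - u) * 0 < r)).exists
  obtain ⟨y, hy⟩ := (U.eventually_const_lt (by linarith : r < u * 1 + (1 - u) * 1)).exists
  obtain ⟨v, hv⟩ := mem_range_of_exists_le_of_exists_ge C ⟨x, hx.le⟩ ⟨y, hy.le⟩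
  exact ⟨v, hv.symm⟩

lemma conv_mem {a b u : ℝ} (ha0 : 0 < a) (ha1 : a < 1) (hb0 : 0 < b) (hb1 : b < 1)
    (hu0 : 0 ≤ u) (hu1 : u ≤ 1) : 0 ≤ u * a + (1 - u) * b ∧ u * a + (1 - u) * b ≤ 1 := by
  constructor <;> nlinarith

lemma mix_mem {a c d : ℝ} (ha0 : 0 < a) (ha1 : a < 1) (hc0 : 0 < c) (hc1 : c < 1)
    (hd0 : 0 < d) (hd1 : d < 1) : 0 < a * c + (1 - a) * d ∧ a * c + (1 - a) * d < 1 := by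
  have := mul_pos ha0 hc0
  have := mul_pos (sub_pos.2 ha1) hd0
  have := mul_pos ha0 (sub_pos.2 hc1)
  have := mul_pos (sub_pos.2 ha1) (sub_pos.2 hd1)
  constructor <;> nlinarith

/-- Log-moment function at a log ratio. -/
lemma Lb_logratio {a C D : ℝ} (ha0 : 0 < a) (ha1 : a < 1) (hC : 0 < C) (hD : 0 < D) :
    Lb a (Real.log C - Real.log D) = Real.log (a * C + (1 - a) * D) - Real.log D := by
  have h : 0 < a * C + (1 - a) * D := add_pos (mul_pos ha0 hC) (mul_pos (sub_pos.2 ha1) hD)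
  unfold Lb
  rw [← Real.log_div h.ne' hD.ne', Real.exp_sub, Real.exp_log hC, Real.exp_log hD]
  congr 1
  field_simp
  ring

lemma th_logratio {a C D : ℝ} (ha0 : 0 < a) (ha1 : a < 1) (hC : 0 < C) (hD : 0 < D) :
    th a (Real.log C - Real.log D) = a * C / (a * C + (1 - a) * D) := by
  have h : 0 < a * C + (1 - a) * D := add_pos (mul_pos ha0 hC) (mul_pos (sub_pos.2 ha1) hD)
  have h2 := den_pos ha0 ha1 (Real.log C - Real.log D)
  unfold th
  rw [div_eq_div_iff h2.ne' h.ne', Real.exp_sub, Real.exp_log hC, Real.exp_log hD]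
  field_simp
  ring

/-- The composition law of log-moment functions. -/
lemma Lb_comp {a c d : ℝ} (ha0 : 0 < a) (ha1 : a < 1) (hc0 : 0 < c) (hc1 : c < 1)
    (hd0 : 0 < d) (hd1 : d < 1) (v : ℝ) :
    Lb a (Lb c v - Lb d v) = Lb (a * c + (1 - a) * d) v - Lb d v := by
  have := Lb_logratio ha0 ha1 (den_pos hc0 hc1 v) (den_pos hd0 hd1 v)
  unfold Lb at this ⊢
  rw [this]
  congr 2
  ring

lemma th_comp {a c d : ℝ} (ha0 : 0 < a) (ha1 : a < 1) (hc0 : 0 < c) (hc1 : c < 1)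
    (hd0 : 0 < d) (hd1 : d < 1) (v : ℝ) :
    th a (Lb c v - Lb d v) * th c v + (1 - th a (Lb c v - Lb d v)) * th d v
      = th (a * c + (1 - a) * d) v := by
  have hC := den_pos hc0 hc1 v
  have hD := den_pos hd0 hd1 v
  have h1 := th_logratio ha0 ha1 hC hD
  have h : 0 < a * (1 - c + Real.exp v * c) + (1 - a) * (1 - d + Real.exp v * d) :=
    add_pos (mul_pos ha0 hC) (mul_pos (sub_pos.2 ha1) hD)
  have e : 1 - (a * c + (1 - a) * d) + Real.exp v * (a * c + (1 - a) * d)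
      = a * (1 - c + Real.exp v * c) + (1 - a) * (1 - d + Real.exp v * d) := by ring
  have h1' : th a (Lb c v - Lb d v) = _ := h1
  rw [h1']
  unfold th
  rw [e]
  generalize hCe : 1 - c + Real.exp v * c = C at *
  generalize hDe : 1 - d + Real.exp v * d = D at *
  field_simp
  ring

lemma main_aux {a b c d u r : ℝ} (ha0 : 0 < a) (ha1 : a < 1) (hb0 : 0 < b) (hb1 : b < 1)
    (hc0 : 0 < c) (hc1 : c < 1) (hd0 : 0 < d) (hd1 : d < 1)
    (hu0 : 0 ≤ u) (hu1 : u ≤ 1) (hr0 : 0 ≤ r) (hr1 : r ≤ 1) :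
    ∃ s ∈ Set.Icc (0:ℝ) 1,
      (∀ s' ∈ Set.Icc (0:ℝ) 1,
        Gr a b u s + Gr c d s r ≤ Gr a b u s' + Gr c d s' r) ∧
      Gr (a * c + (1 - a) * d) (b * c + (1 - b) * d) u r = Gr a b u s + Gr c d s r := by
  obtain ⟨hA0, hA1⟩ := mix_mem ha0 ha1 hc0 hc1 hd0 hd1
  obtain ⟨hB0, hB1⟩ := mix_mem hb0 hb1 hc0 hc1 hd0 hd1
  have lower : ∀ s' ∈ Set.Icc (0:ℝ) 1,
      Gr (a * c + (1 - a) * d) (b * c + (1 - b) * d) u r ≤ Gr a b u s' + Gr c d s' r := by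
    rintro s ⟨hs0, hs1⟩
    refine ciSup_le fun v => ?_
    have h1 := le_Gr ha0 ha1 hb0 hb1 hu0 hu1 hs0 hs1 (Lb c v - Lb d v)
    have h2 := le_Gr hc0 hc1 hd0 hd1 hs0 hs1 hr0 hr1 v
    rw [Lb_comp ha0 ha1 hc0 hc1 hd0 hd1, Lb_comp hb0 hb1 hc0 hc1 hd0 hd1] at h1
    linarith
  suffices H : ∃ s ∈ Set.Icc (0:ℝ) 1,
      Gr a b u s + Gr c d s r ≤ Gr (a * c + (1 - a) * d) (b * c + (1 - b) * d) u r by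
    obtain ⟨s, hs, h⟩ := H
    exact ⟨s, hs, fun s' hs' => h.trans (lower s' hs'), le_antisymm (lower s hs) h⟩
  have smem : ∀ w, u * th a w + (1 - u) * th b w ∈ Set.Icc (0:ℝ) 1 := fun w =>
    conv_mem (th_pos ha0 ha1 w) (th_lt ha0 ha1 w) (th_pos hb0 hb1 w) (th_lt hb0 hb1 w) hu0 hu1
  rcases hr0.eq_or_lt with rfl | hr0'
  · have hc : 0 < 1 - c := by linarith
    have hd : 0 < 1 - d := by linarith
    refine ⟨_, smem (Real.log (1 - c) - Real.log (1 - d)), ?_⟩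
    obtain ⟨hs0, hs1⟩ := smem (Real.log (1 - c) - Real.log (1 - d))
    have h1 := Gr_le_tilt ha0 ha1 hb0 hb1 hu0 hu1 (Real.log (1 - c) - Real.log (1 - d)) rfl
    have h2 := Gr_le hc0 hc1 hd0 hd1 hs0 hs1 hr0 hr1
    have h3 := Gr_zero_ge hA0 hA1 hB0 hB1 hu0 hu1
    rw [Lb_logratio ha0 ha1 hc hd, Lb_logratio hb0 hb1 hc hd] at h1
    rw [show 1 - (a * c + (1 - a) * d) = a * (1 - c) + (1 - a) * (1 - d) by ring,
      show 1 - (b * c + (1 - b) * d) = b * (1 - c) + (1 - b) * (1 - d) by ring] at h3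
    linarith
  rcases hr1.eq_or_lt with rfl | hr1'
  · refine ⟨_, smem (Real.log c - Real.log d), ?_⟩
    obtain ⟨hs0, hs1⟩ := smem (Real.log c - Real.log d)
    have h1 := Gr_le_tilt ha0 ha1 hb0 hb1 hu0 hu1 (Real.log c - Real.log d) rfl
    have h2 := Gr_le hc0 hc1 hd0 hd1 hs0 hs1 hr0 hr1
    have h3 := Gr_one_ge hA0 hA1 hB0 hB1 hu0 hu1
    rw [Lb_logratio ha0 ha1 hc0 hd0, Lb_logratio hb0 hb1 hc0 hd0] at h1
    linarith
  · obtain ⟨v, hv⟩ := exists_tilt (u := u) hA0 hA1 hB0 hB1 hr0' hr1'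
    refine ⟨_, smem (Lb c v - Lb d v), ?_⟩
    obtain ⟨hs0, hs1⟩ := smem (Lb c v - Lb d v)
    have h1 := Gr_le_tilt ha0 ha1 hb0 hb1 hu0 hu1 (Lb c v - Lb d v) rfl
    have h2 := Gr_le_tilt (x := r) hc0 hc1 hd0 hd1 hs0 hs1 v (by
      rw [hv, ← th_comp ha0 ha1 hc0 hc1 hd0 hd1, ← th_comp hb0 hb1 hc0 hc1 hd0 hd1]
      ring)
    have h3 := le_Gr hA0 hA1 hB0 hB1 hu0 hu1 hr0 hr1 v
    rw [Lb_comp ha0 ha1 hc0 hc1 hd0 hd1, Lb_comp hb0 hb1 hc0 hc1 hd0 hd1] at h1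
    linarith

lemma p_bounds {lam mu t : ℝ} (hlam : 0 < lam) (hmu : 0 < mu) (ht : 0 < t) :
    (0 < p11 lam mu t ∧ p11 lam mu t < 1) ∧ (0 < p01 lam mu t ∧ p01 lam mu t < 1) := by
  have hs : 0 < lam + mu := by linarith
  have he : Real.exp (-(t * (lam + mu))) < 1 := by
    rw [Real.exp_lt_one_iff]
    have := mul_pos ht hs
    linarith
  have hp := Real.exp_pos (-(t * (lam + mu)))
  unfold p11 p01
  refine ⟨⟨by positivity, ?_⟩, div_pos (by nlinarith) hs, ?_⟩ <;> rw [div_lt_one hs] <;> nlinarith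

/-- Chapman-Kolmogorov-type identity for the rate function: the two-step rate with an optimally
chosen midpoint equals the one-step rate. -/
theorem stmt_7 (lam mu t T : ℝ) (hlam : 0 < lam) (hmu : 0 < mu) (ht : 0 < t) (htT : t < T)
    (u r : ℝ) (hu : u ∈ Set.Icc (0:ℝ) 1) (hr : r ∈ Set.Icc (0:ℝ) 1) :
    ∃ s ∈ Set.Icc (0:ℝ) 1,
      (∀ s' ∈ Set.Icc (0:ℝ) 1,
        I1 lam mu t u s + I1 lam mu (T - t) s r ≤ I1 lam mu t u s' + I1 lam mu (T - t) s' r) ∧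
      I1 lam mu T u r = I1 lam mu t u s + I1 lam mu (T - t) s r := by
  have hs : lam + mu ≠ 0 := by linarith
  obtain ⟨⟨ha0, ha1⟩, hb0, hb1⟩ := p_bounds hlam hmu ht
  obtain ⟨⟨hc0, hc1⟩, hd0, hd1⟩ := p_bounds hlam hmu (sub_pos.2 htT)
  have h := main_aux ha0 ha1 hb0 hb1 hc0 hc1 hd0 hd1 hu.1 hu.2 hr.1 hr.2
  have hE : Real.exp (-(T * (lam + mu)))
      = Real.exp (-(t * (lam + mu))) * Real.exp (-((T - t) * (lam + mu))) := by
    rw [← Real.exp_add]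
    congr 1
    ring
  have e1 : p11 lam mu t * p11 lam mu (T - t) + (1 - p11 lam mu t) * p01 lam mu (T - t)
      = p11 lam mu T := by
    unfold p11 p01
    rw [hE]
    field_simp
    ring
  have e2 : p01 lam mu t * p11 lam mu (T - t) + (1 - p01 lam mu t) * p01 lam mu (T - t)
      = p01 lam mu T := by
    unfold p11 p01
    rw [hE]
    field_simp
    ring
  rw [e1, e2] at h
  exact h
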